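/- For all y1, y2 ∈ X_d (differences of symmetric probability measures), H(y1) = −Σ_{k=1}^{∞} (1/(log 2 · 2k(2k−1))) · M_k(y1) and H(y1 ⊠ y2) = −Σ_{k=1}^{∞} (1/(log 2 · 2k(2k−1))) · M_k(y1)·M_k(y2), where the operation ⊠ and H are extended bilinearly and linearly to signed measures. -/

import Mathlib

open MeasureTheory Real Filter Topology Polynomial

noncomputable section

/-- The space of finite signed Borel measures on the extended reals `ℝ̄`. -/
abbrev SM := MeasureTheory.SignedMeasure EReal

namespace SCLDPC

/-- The weight `e^{-α/2}` as an extended nonnegative real (`+∞` at `α = -∞`). -/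
def wt (α : EReal) : ENNReal :=
  if α = ⊥ then ⊤ else if α = ⊤ then 0 else ENNReal.ofReal (Real.exp (-(α.toReal) / 2))

/-- A (nonnegative) Borel measure `μ` on `ℝ̄` is symmetric if
`∫_{-E} e^{-α/2} μ(dα) = ∫_{E} e^{-α/2} μ(dα)` for every Borel set `E`
(stated with extended nonnegative integrals, which is equivalent to requiring
equality whenever one of the two sides is finite). -/
def IsSymmMeasure (μ : Measure EReal) : Prop :=
  ∀ E : Set EReal, MeasurableSet E →
    ∫⁻ α in (fun a : EReal => -a) ⁻¹' E, wt α ∂μ = ∫⁻ α in E, wt α ∂μ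

/-- Positive part of the Jordan decomposition. -/
def jp (x : SM) : Measure EReal := x.toJordanDecomposition.posPart

/-- Negative part of the Jordan decomposition. -/
def jn (x : SM) : Measure EReal := x.toJordanDecomposition.negPart

instance (x : SM) : IsFiniteMeasure (jp x) := x.toJordanDecomposition.posPart_finite

instance (x : SM) : IsFiniteMeasure (jn x) := x.toJordanDecomposition.negPart_finite

/-- A finite signed Borel measure on `ℝ̄` is symmetric iff both parts of its Jordan
decomposition are symmetric measures. -/
def IsSymm (x : SM) : Prop := IsSymmMeasure (jp x) ∧ IsSymmMeasure (jn x)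

/-- Membership in `X`, the set of symmetric probability measures on `ℝ̄`. -/
def MemX (x : SM) : Prop :=
  (∃ (μ : Measure EReal) (hμ : IsProbabilityMeasure μ),
      x = (letI := hμ; μ.toSignedMeasure)) ∧ IsSymm x

/-- Membership in `X_d`, the set of differences of symmetric probability measures. -/
def MemXd (y : SM) : Prop := ∃ x1 x2 : SM, MemX x1 ∧ MemX x2 ∧ y = x1 - x2

/-- Integral of a real function against a finite signed measure. -/
def sInt (f : EReal → ℝ) (x : SM) : ℝ := (∫ α, f α ∂(jp x)) - ∫ α, f α ∂(jn x)

/-- `tanh(α/2)` extended continuously to `ℝ̄`. -/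
def tanhHalf (α : EReal) : ℝ :=
  if α = ⊤ then 1 else if α = ⊥ then -1 else Real.tanh (α.toReal / 2)

/-- The inverse hyperbolic tangent on `(-1, 1)`. -/
def artanh (t : ℝ) : ℝ := Real.log ((1 + t) / (1 - t)) / 2

/-- `2 tanh⁻¹(t)` valued in `ℝ̄` (sending `t ≥ 1` to `+∞` and `t ≤ -1` to `-∞`). -/
def atanhTwo (t : ℝ) : EReal :=
  if 1 ≤ t then ⊤ else if t ≤ -1 then ⊥ else ((2 * artanh t : ℝ) : EReal)

/-- Variable-node convolution `⊛` of two (nonnegative) measures: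
`(μ ⊛ ν)(E) = ∫ μ(E - α) ν(dα)`, i.e. the pushforward of `μ × ν` under addition. -/
def mConv (μ ν : Measure EReal) : Measure EReal :=
  (μ.prod ν).map fun p => p.1 + p.2

/-- Check-node convolution `⊠` of two (nonnegative) measures:
`(μ ⊠ ν)(E) = ∫ μ(2 tanh⁻¹(tanh(E/2) / tanh(α/2))) ν(dα)`, where the argument of `μ`
is the image of `E` under `β ↦ 2 tanh⁻¹(tanh(β/2) / tanh(α/2))`; equivalently, the
pushforward of `μ × ν` under `(β, α) ↦ 2 tanh⁻¹(tanh(β/2) · tanh(α/2))`. -/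
def mCheck (μ ν : Measure EReal) : Measure EReal :=
  (μ.prod ν).map fun p => atanhTwo (tanhHalf p.1 * tanhHalf p.2)

instance (μ ν : Measure EReal) [IsFiniteMeasure μ] [IsFiniteMeasure ν] :
    IsFiniteMeasure (mConv μ ν) := by unfold mConv; infer_instance

instance (μ ν : Measure EReal) [IsFiniteMeasure μ] [IsFiniteMeasure ν] :
    IsFiniteMeasure (mCheck μ ν) := by unfold mCheck; infer_instance

/-- The variable-node operation `⊛` extended bilinearly to finite signed measures. -/
def sConv (x y : SM) : SM :=
  (mConv (jp x) (jp y)).toSignedMeasure - (mConv (jp x) (jn y)).toSignedMeasure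
    - (mConv (jn x) (jp y)).toSignedMeasure + (mConv (jn x) (jn y)).toSignedMeasure

/-- The check-node operation `⊠` extended bilinearly to finite signed measures. -/
def sCheck (x y : SM) : SM :=
  (mCheck (jp x) (jp y)).toSignedMeasure - (mCheck (jp x) (jn y)).toSignedMeasure
    - (mCheck (jn x) (jp y)).toSignedMeasure + (mCheck (jn x) (jn y)).toSignedMeasure

/-- The integrand `log₂(1 + e^{-α})` of the entropy functional (with the harmless
convention that it vanishes at `α = ±∞`; symmetric measures put no mass at `-∞`). -/
def entFn (α : EReal) : ℝ :=
  if α = ⊤ then 0 else if α = ⊥ then 0 else Real.logb 2 (1 + Real.exp (-(α.toReal)))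

/-- The entropy functional `H(x) = ∫ log₂(1 + e^{-α}) x(dα)`. -/
def H (x : SM) : ℝ := sInt entFn x

/-- The tanh-moment functional `M_k(x) = ∫ tanh(α/2)^{2k} x(dα)`. -/
def Mfun (k : ℕ) (x : SM) : ℝ := sInt (fun α => tanhHalf α ^ (2 * k)) x

/-- The coefficient `(log 2)⁻¹ / (2k (2k - 1))` of the entropy series. -/
def serCoef (k : ℕ) : ℝ := (Real.log 2 * (2 * (k : ℝ)) * (2 * (k : ℝ) - 1))⁻¹

/-- The entropy integrand in the `t = tanh(α/2)` coordinate. -/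
def Lf (t : ℝ) : ℝ := -Real.logb 2 ((1 + t) / 2)

lemma Lf_measurable : Measurable Lf := by
  unfold Lf Real.logb
  fun_prop

lemma Lf_nonneg {t : ℝ} (h : |t| ≤ 1) : 0 ≤ Lf t := by
  obtain ⟨h1, h2⟩ := abs_le.1 h
  unfold Lf
  have := Real.logb_nonpos (b := 2) (by norm_num) (x := (1 + t) / 2) (by linarith) (by linarith)
  linarith

/-- Binary entropy in the `t` coordinate. -/
def Df (t : ℝ) : ℝ := Real.binEntropy ((1 + t) / 2) / Real.log 2

lemma Df_cont : Continuous Df := by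
  unfold Df
  fun_prop

lemma Df_eq (t : ℝ) : 2 * Df t = Lf t * (1 + t) + Lf (-t) * (1 - t) := by
  unfold Df Lf Real.binEntropy Real.logb
  have : 1 - (1 + t) / 2 = (1 + -t) / 2 := by ring
  rw [this, Real.log_inv, Real.log_inv]
  ring

lemma serCoef_nonneg (k : ℕ) : 0 ≤ serCoef (k + 1) := by
  unfold serCoef
  have := Real.log_pos (x := 2) (by norm_num)
  have h : (0:ℝ) ≤ k := by positivity
  push_cast
  have : (0:ℝ) ≤ 2 * (k + 1) - 1 := by linarith
  positivity

lemma serCoef_summable : Summable (fun k : ℕ => serCoef (k + 1)) := by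
  have h2 := Real.log_pos (x := 2) (by norm_num)
  have h : Summable (fun k : ℕ => (Real.log 2)⁻¹ * (1 / ((k + 1 : ℕ) : ℝ) ^ 2)) :=
    ((summable_nat_add_iff 1).2 (Real.summable_one_div_nat_pow.2 (by norm_num : 1 < 2))).mul_left _
  refine Summable.of_nonneg_of_le serCoef_nonneg (fun k => ?_) h
  unfold serCoef
  have hk : (0:ℝ) ≤ k := by positivity
  rw [one_div, ← mul_inv]
  push_cast
  apply inv_anti₀ (by positivity)
  rw [mul_assoc]
  apply mul_le_mul_of_nonneg_left _ h2.le
  nlinarith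

lemma hasSum_open {t : ℝ} (h : |t| < 1) :
    HasSum (fun k : ℕ => serCoef (k + 1) * t ^ (2 * (k + 1))) (1 - Df t) := by
  have h2 := Real.log_pos (x := 2) (by norm_num)
  obtain ⟨l, u⟩ := abs_lt.1 h
  have s1 := (Real.hasSum_log_sub_log_of_abs_lt_one h).mul_left (t / 2)
  have s2 := Real.hasSum_pow_div_log_of_abs_lt_one (x := t ^ 2) (by
    rw [abs_pow, ← abs_pow, abs_of_nonneg (sq_nonneg t)]; nlinarith)
  have s3 := (s1.sub (s2.mul_left (1 / 2))).mul_left (Real.log 2)⁻¹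
  convert! s3 using 1
  · funext k
    unfold serCoef
    have hk : (0:ℝ) ≤ k := by positivity
    have e1 : (2 * (k:ℝ) + 1) ≠ 0 := by positivity
    have e2 : ((k:ℝ) + 1) ≠ 0 := by positivity
    push_cast
    rw [show 2 * ((k:ℝ) + 1) - 1 = 2 * k + 1 by ring]
    have : (t ^ 2) ^ (k + 1) = t ^ (2 * (k + 1)) := by rw [← pow_mul]
    rw [this, show 2 * (k + 1) = 2 * k + 1 + 1 by ring, pow_succ]
    field_simp
    ring
  · have e : 1 - t ^ 2 = (1 + t) * (1 - t) := by ring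
    rw [e, Real.log_mul (by linarith) (by linarith)]
    unfold Df Real.binEntropy
    rw [show 1 - (1 + t) / 2 = (1 - t) / 2 by ring, Real.log_inv, Real.log_inv,
      Real.log_div (by linarith) (by norm_num), Real.log_div (by linarith) (by norm_num)]
    field_simp
    ring

lemma term_norm_le (k : ℕ) {t : ℝ} (h : |t| ≤ 1) :
    ‖serCoef (k + 1) * t ^ (2 * (k + 1))‖ ≤ serCoef (k + 1) := by
  rw [norm_mul, Real.norm_of_nonneg (serCoef_nonneg k), norm_pow]
  exact mul_le_of_le_one_right (serCoef_nonneg k) (pow_le_one₀ (norm_nonneg _) h)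

lemma hasSum_closed {t : ℝ} (h : |t| ≤ 1) :
    HasSum (fun k : ℕ => serCoef (k + 1) * t ^ (2 * (k + 1))) (1 - Df t) := by
  have hc : ContinuousOn (fun t : ℝ => ∑' k : ℕ, serCoef (k + 1) * t ^ (2 * (k + 1)))
      (Set.Icc (-1) 1) :=
    continuousOn_tsum (fun k => by fun_prop) serCoef_summable
      (fun k x hx => term_norm_le k (abs_le.2 hx))
  have he : Set.EqOn (fun t : ℝ => ∑' k : ℕ, serCoef (k + 1) * t ^ (2 * (k + 1)))
      (fun t => 1 - Df t) (Set.Ioo (-1) 1) := fun x hx => (hasSum_open (abs_lt.2 hx)).tsum_eq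
  have hd : ContinuousOn (fun t => 1 - Df t) (Set.Icc (-1) 1) :=
    (continuous_const.sub Df_cont).continuousOn
  have he' := he.of_subset_closure hc hd Set.Ioo_subset_Icc_self
    (by rw [closure_Ioo (by norm_num)])
  have hs : Summable (fun k : ℕ => serCoef (k + 1) * t ^ (2 * (k + 1))) :=
    Summable.of_norm_bounded serCoef_summable (fun k => term_norm_le k h)
  have := he' (abs_le.1 h)
  beta_reduce at this
  rw [← this]
  exact hs.hasSum

/-- Symmetry of a measure in the `t` coordinate. -/
def TSymm {Ω : Type*} [MeasurableSpace Ω] (μ : Measure Ω) (T : Ω → ℝ) : Prop :=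
  ∀ g : ℝ → ENNReal, Measurable g →
    ∫⁻ a, g (T a) * ENNReal.ofReal (1 - T a) ∂μ = ∫⁻ a, g (-T a) * ENNReal.ofReal (1 - T a) ∂μ

lemma lint_Lf {Ω : Type*} [MeasurableSpace Ω] (μ : Measure Ω) (T : Ω → ℝ)
    (hT : Measurable T) (hb : ∀ a, |T a| ≤ 1) (hs : TSymm μ T) :
    ∫⁻ a, ENNReal.ofReal (Lf (T a)) ∂μ = ∫⁻ a, ENNReal.ofReal (Df (T a)) ∂μ := by
  have hL := Lf_measurable
  have key := hs (fun t => ENNReal.ofReal (Lf t)) (by fun_prop)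
  beta_reduce at key
  have e1 : ∫⁻ a, 2 * ENNReal.ofReal (Lf (T a)) ∂μ = ∫⁻ a, 2 * ENNReal.ofReal (Df (T a)) ∂μ := by
    calc _ = ∫⁻ a, (ENNReal.ofReal (Lf (T a)) * ENNReal.ofReal (1 + T a)
          + ENNReal.ofReal (Lf (T a)) * ENNReal.ofReal (1 - T a)) ∂μ := by
          congr 1; funext a
          obtain ⟨l, u⟩ := abs_le.1 (hb a)
          rw [← mul_add, ← ENNReal.ofReal_add (by linarith) (by linarith)]
          ring_nf
          simp
      _ = ∫⁻ a, (ENNReal.ofReal (Lf (T a)) * ENNReal.ofReal (1 + T a)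
          + ENNReal.ofReal (Lf (-T a)) * ENNReal.ofReal (1 - T a)) ∂μ := by
          rw [lintegral_add_left (by fun_prop), lintegral_add_left (by fun_prop), key]
      _ = _ := by
          congr 1; funext a
          obtain ⟨l, u⟩ := abs_le.1 (hb a)
          have p1 := Lf_nonneg (hb a)
          have p2 := Lf_nonneg (t := -T a) (by rw [abs_neg]; exact hb a)
          rw [← ENNReal.ofReal_mul p1, ← ENNReal.ofReal_mul p2,
            ← ENNReal.ofReal_add (mul_nonneg p1 (by linarith)) (mul_nonneg p2 (by linarith)),
            ← Df_eq, ENNReal.ofReal_mul (by norm_num)]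
          simp
  rw [lintegral_const_mul' _ _ (by simp), lintegral_const_mul' _ _ (by simp)] at e1
  exact (ENNReal.mul_right_inj (by simp) (by simp)).1 e1

lemma Df_bounds {t : ℝ} (h : |t| ≤ 1) : 0 ≤ Df t ∧ Df t ≤ 1 := by
  have h2 := Real.log_pos (x := 2) (by norm_num)
  obtain ⟨l, u⟩ := abs_le.1 h
  unfold Df
  exact ⟨div_nonneg (Real.binEntropy_nonneg (by linarith) (by linarith)) h2.le,
    (div_le_one h2).2 Real.binEntropy_le_log_two⟩

lemma core {Ω : Type*} [MeasurableSpace Ω] (μ : Measure Ω) [IsFiniteMeasure μ] (T : Ω → ℝ)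
    (hT : Measurable T) (hb : ∀ a, |T a| ≤ 1) (hs : TSymm μ T) :
    Integrable (fun a => Lf (T a)) μ ∧
    HasSum (fun k : ℕ => serCoef (k + 1) * ∫ a, T a ^ (2 * (k + 1)) ∂μ)
      (μ.real Set.univ - ∫ a, Lf (T a) ∂μ) := by
  have hL := Lf_measurable
  have hDm := Df_cont.measurable
  have hl := lint_Lf μ T hT hb hs
  have hDs : AEStronglyMeasurable (fun a => Df (T a)) μ := (hDm.comp hT).aestronglyMeasurable
  have hLs : AEStronglyMeasurable (fun a => Lf (T a)) μ := (hL.comp hT).aestronglyMeasurable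
  have hDi : Integrable (fun a => Df (T a)) μ := by
    refine Integrable.of_bound (C := 1) hDs (ae_of_all _ fun a => ?_)
    rw [Real.norm_of_nonneg (Df_bounds (hb a)).1]
    exact (Df_bounds (hb a)).2
  have hnL : 0 ≤ᵐ[μ] fun a => Lf (T a) := ae_of_all _ fun a => Lf_nonneg (hb a)
  have hnD : 0 ≤ᵐ[μ] fun a => Df (T a) := ae_of_all _ fun a => (Df_bounds (hb a)).1
  have hLi : Integrable (fun a => Lf (T a)) μ := by
    refine ⟨hLs, ?_⟩
    rw [hasFiniteIntegral_iff_ofReal hnL, hl, ← hasFiniteIntegral_iff_ofReal hnD]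
    exact hDi.2
  refine ⟨hLi, ?_⟩
  have hI : ∫ a, Lf (T a) ∂μ = ∫ a, Df (T a) ∂μ := by
    rw [integral_eq_lintegral_of_nonneg_ae hnL hLs,
      integral_eq_lintegral_of_nonneg_ae hnD hDs, hl]
  have := hasSum_integral_of_dominated_convergence (μ := μ)
    (F := fun (k : ℕ) a => serCoef (k + 1) * T a ^ (2 * (k + 1))) (f := fun a => 1 - Df (T a))
    (fun k _ => serCoef (k + 1)) (fun k => by fun_prop)
    (fun k => ae_of_all _ fun a => term_norm_le k (hb a))
    (ae_of_all _ fun a => serCoef_summable) (integrable_const _)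
    (ae_of_all _ fun a => hasSum_closed (hb a))
  rw [integral_sub (integrable_const _) hDi, ← hI] at this
  simpa [integral_const_mul] using this

lemma tanhHalf_measurable : Measurable tanhHalf := by
  apply EReal.measurable_of_measurable_real
  simp only [tanhHalf, EReal.coe_ne_top, EReal.coe_ne_bot, if_false, EReal.toReal_coe]
  have : Continuous Real.tanh := by
    have : Real.tanh = fun x => Real.sinh x / Real.cosh x := by
      funext x; exact Real.tanh_eq_sinh_div_cosh x
    rw [this]
    exact Real.continuous_sinh.div Real.continuous_cosh (fun x => (Real.cosh_pos x).ne')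
  exact (this.comp (continuous_id.div_const 2)).measurable

lemma tanhHalf_abs (a : EReal) : |tanhHalf a| ≤ 1 := by
  unfold tanhHalf
  split_ifs
  · simp
  · simp
  · have := Real.tanh_bijOn.mapsTo (Set.mem_univ (a.toReal / 2))
    exact abs_le.2 ⟨this.1.le, this.2.le⟩

lemma tanhHalf_neg (a : EReal) : tanhHalf (-a) = -tanhHalf a := by
  induction a with
  | bot => simp [tanhHalf]
  | top => simp [tanhHalf]
  | coe x =>
    rw [← EReal.coe_neg]
    simp [tanhHalf, neg_div, Real.tanh_neg]

lemma one_sub_tanh (x : ℝ) : 1 - Real.tanh (x / 2) = Real.exp (-x / 2) * (Real.cosh (x / 2))⁻¹ := by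
  rw [Real.tanh_eq_sinh_div_cosh, neg_div, ← Real.cosh_sub_sinh]
  have := (Real.cosh_pos (x / 2)).ne'
  field_simp

lemma one_add_tanh (x : ℝ) : (1 + Real.tanh (x / 2)) / 2 = (1 + Real.exp (-x))⁻¹ := by
  rw [Real.tanh_eq_sinh_div_cosh, Real.sinh_eq, Real.cosh_eq]
  have e : Real.exp (-x) = Real.exp (-(x / 2)) * Real.exp (-(x / 2)) := by
    rw [← Real.exp_add]; ring_nf
  have e2 : Real.exp (-(x / 2)) * Real.exp (x / 2) = 1 := by
    rw [← Real.exp_add]; simp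
  rw [e]
  have p1 := Real.exp_pos (-(x / 2))
  have p2 := Real.exp_pos (x / 2)
  generalize Real.exp (-(x / 2)) = u at *
  generalize Real.exp (x / 2) = v at *
  field_simp
  linear_combination (2 * u) * e2

lemma entFn_eq (a : EReal) : entFn a = Lf (tanhHalf a) := by
  induction a with
  | bot => simp [tanhHalf, entFn, Lf]
  | top => simp [tanhHalf, entFn, Lf]
  | coe x =>
    simp only [tanhHalf, entFn, Lf, EReal.coe_ne_top, EReal.coe_ne_bot, if_false, EReal.toReal_coe]
    rw [one_add_tanh, Real.logb_inv, neg_neg]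

lemma tanhHalf_atanhTwo {t : ℝ} (h : |t| ≤ 1) : tanhHalf (atanhTwo t) = t := by
  obtain ⟨l, u⟩ := abs_le.1 h
  unfold atanhTwo
  split_ifs with h1 h2
  · simp [tanhHalf]; linarith
  · simp [tanhHalf]; linarith
  · simp only [tanhHalf, EReal.coe_ne_top, EReal.coe_ne_bot, if_false, EReal.toReal_coe]
    rw [mul_div_cancel_left₀ _ (by norm_num)]
    push Not at h1 h2
    have : SCLDPC.artanh t = Real.artanh t := by
      rw [Real.artanh_eq_half_log ⟨l, u⟩]; unfold SCLDPC.artanh; ring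
    rw [this, Real.tanh_artanh ⟨h2, h1⟩]

lemma atanhTwo_measurable : Measurable atanhTwo := by
  unfold atanhTwo SCLDPC.artanh
  refine Measurable.ite measurableSet_Ici measurable_const
    (Measurable.ite measurableSet_Iic measurable_const ?_)
  exact measurable_coe_real_ereal.comp (by fun_prop)

lemma wt_measurable : Measurable wt := by
  apply EReal.measurable_of_measurable_real
  simp only [wt, EReal.coe_ne_top, EReal.coe_ne_bot, if_false, EReal.toReal_coe]
  fun_prop

lemma IsSymmMeasure.tsymm {μ : Measure EReal} (h : IsSymmMeasure μ) : TSymm μ tanhHalf := by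
  have hT := tanhHalf_measurable
  have hbot : ∀ᵐ a ∂μ, a ≠ ⊥ := by
    have := h {⊤} (measurableSet_singleton _)
    have e : (fun a : EReal => -a) ⁻¹' {⊤} = {⊥} := by
      ext a; simp
    rw [e] at this
    simp only [lintegral_singleton] at this
    simp [wt] at this
    rw [ae_iff]
    simpa using this
  have hm : (μ.withDensity wt).map (fun a : EReal => -a) = μ.withDensity wt := by
    ext E hE
    rw [Measure.map_apply measurable_neg hE, withDensity_apply _ (measurable_neg hE),
      withDensity_apply _ hE]
    exact h E hE
  intro g hg
  set c : EReal → ENNReal := fun a => ENNReal.ofReal (Real.cosh (a.toReal / 2))⁻¹ with hc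
  have hcm : Measurable c := by
    have := Real.continuous_cosh.measurable
    have h2 : Measurable EReal.toReal := measurable_ereal_toReal
    exact ENNReal.measurable_ofReal.comp ((this.comp (h2.div_const 2)).inv)
  have hcn : ∀ a, c (-a) = c a := by
    intro a
    simp only [hc, EReal.toReal_neg_eq, neg_div, Real.cosh_neg]
  have hw : ∀ a, a ≠ ⊥ → wt a * c a = ENNReal.ofReal (1 - tanhHalf a) := by
    intro a ha
    induction a with
    | bot => exact absurd rfl ha
    | top => simp [wt, tanhHalf]
    | coe x =>
      simp only [wt, tanhHalf, hc, EReal.coe_ne_top, EReal.coe_ne_bot, if_false, EReal.toReal_coe]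
      rw [one_sub_tanh, ENNReal.ofReal_mul (Real.exp_pos _).le]
  have main : ∀ g : ℝ → ENNReal, Measurable g →
      ∫⁻ a, g (tanhHalf a) * ENNReal.ofReal (1 - tanhHalf a) ∂μ
        = ∫⁻ a, g (tanhHalf a) * c a ∂(μ.withDensity wt) := by
    intro g hg
    rw [lintegral_withDensity_eq_lintegral_mul _ wt_measurable (show Measurable (fun a => g (tanhHalf a) * c a) from
      (hg.comp hT).mul hcm)]
    refine lintegral_congr_ae ?_
    filter_upwards [hbot] with a ha
    rw [← hw a ha]
    simp only [Pi.mul_apply]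
    ring
  rw [main g hg, main (fun t => g (-t)) (hg.comp measurable_neg)]
  conv_lhs => rw [← hm]
  rw [lintegral_map (show Measurable (fun a => g (tanhHalf a) * c a) from (hg.comp hT).mul hcm)
    (show Measurable (fun a : EReal => -a) from measurable_neg)]
  simp only [hcn, tanhHalf_neg]

lemma tsymm_prod {μ ν : Measure EReal} [IsFiniteMeasure μ] [IsFiniteMeasure ν]
    (h1 : TSymm μ tanhHalf) (h2 : TSymm ν tanhHalf) :
    TSymm (μ.prod ν) (fun p : EReal × EReal => tanhHalf p.1 * tanhHalf p.2) := by
  have hT := tanhHalf_measurable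
  intro g hg
  have split : ∀ g : ℝ → ENNReal, Measurable g →
      2 * ∫⁻ p : EReal × EReal, g (tanhHalf p.1 * tanhHalf p.2)
          * ENNReal.ofReal (1 - tanhHalf p.1 * tanhHalf p.2) ∂(μ.prod ν)
      = (∫⁻ b, (∫⁻ a, g (tanhHalf a * tanhHalf b) * ENNReal.ofReal (1 - tanhHalf a) ∂μ)
            * ENNReal.ofReal (1 + tanhHalf b) ∂ν)
        + ∫⁻ a, (∫⁻ b, g (tanhHalf a * tanhHalf b) * ENNReal.ofReal (1 - tanhHalf b) ∂ν)
            * ENNReal.ofReal (1 + tanhHalf a) ∂μ := by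
    intro g hg
    have m1 : Measurable (fun p : EReal × EReal => g (tanhHalf p.1 * tanhHalf p.2)
        * ENNReal.ofReal (1 - tanhHalf p.1) * ENNReal.ofReal (1 + tanhHalf p.2)) := by fun_prop
    have m2 : Measurable (fun p : EReal × EReal => g (tanhHalf p.1 * tanhHalf p.2)
        * ENNReal.ofReal (1 - tanhHalf p.2) * ENNReal.ofReal (1 + tanhHalf p.1)) := by fun_prop
    calc _ = ∫⁻ p : EReal × EReal, (g (tanhHalf p.1 * tanhHalf p.2)
        * ENNReal.ofReal (1 - tanhHalf p.1) * ENNReal.ofReal (1 + tanhHalf p.2)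
        + g (tanhHalf p.1 * tanhHalf p.2)
        * ENNReal.ofReal (1 - tanhHalf p.2) * ENNReal.ofReal (1 + tanhHalf p.1)) ∂(μ.prod ν) := by
          rw [← lintegral_const_mul' _ _ (by simp)]
          congr 1; funext p
          obtain ⟨l1, u1⟩ := abs_le.1 (tanhHalf_abs p.1)
          obtain ⟨l2, u2⟩ := abs_le.1 (tanhHalf_abs p.2)
          rw [mul_assoc (g _), mul_assoc (g _), ← mul_add, ← ENNReal.ofReal_mul (by linarith),
            ← ENNReal.ofReal_mul (by linarith),
            ← ENNReal.ofReal_add (mul_nonneg (by linarith) (by linarith))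
              (mul_nonneg (by linarith) (by linarith)), mul_left_comm]
          congr 1
          rw [show (2 : ENNReal) = ENNReal.ofReal 2 by simp, ← ENNReal.ofReal_mul (by norm_num)]
          congr 1
          ring
      _ = _ := by
          rw [lintegral_add_left m1, lintegral_prod_symm _ m1.aemeasurable,
            lintegral_prod _ m2.aemeasurable]
          congr 1
          · congr 1; funext b
            rw [← lintegral_mul_const' _ _ ENNReal.ofReal_ne_top]
          · congr 1; funext b
            rw [← lintegral_mul_const' _ _ ENNReal.ofReal_ne_top]
  have hgn : Measurable (fun t : ℝ => g (-t)) := hg.comp measurable_neg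
  have e : 2 * ∫⁻ p : EReal × EReal, g (tanhHalf p.1 * tanhHalf p.2)
          * ENNReal.ofReal (1 - tanhHalf p.1 * tanhHalf p.2) ∂(μ.prod ν)
      = 2 * ∫⁻ p : EReal × EReal, g (-(tanhHalf p.1 * tanhHalf p.2))
          * ENNReal.ofReal (1 - tanhHalf p.1 * tanhHalf p.2) ∂(μ.prod ν) := by
    rw [split g hg, split (fun t => g (-t)) hgn]
    congr 1
    · congr 1; funext b
      have := h1 (fun t => g (t * tanhHalf b)) (by fun_prop)
      simp only [neg_mul] at this
      rw [this]
    · congr 1; funext a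
      have := h2 (fun t => g (tanhHalf a * t)) (by fun_prop)
      simp only [mul_neg] at this
      rw [this]
  exact (ENNReal.mul_right_inj (by simp) (by simp)).1 e

lemma jordan_add {a b : Measure EReal} [IsFiniteMeasure a] [IsFiniteMeasure b] {y : SM}
    (h : y = a.toSignedMeasure - b.toSignedMeasure) : jp y + b = jn y + a := by
  have h1 := y.toSignedMeasure_toJordanDecomposition
  have h2 : (jp y).toSignedMeasure - (jn y).toSignedMeasure
      = a.toSignedMeasure - b.toSignedMeasure := by rw [← h]; exact h1
  rw [← Measure.toSignedMeasure_eq_toSignedMeasure_iff, Measure.toSignedMeasure_add,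
    Measure.toSignedMeasure_add, add_comm (jn y).toSignedMeasure]
  exact sub_eq_sub_iff_add_eq_add.1 h2

lemma jp_eq {a b : Measure EReal} [IsFiniteMeasure a] [IsFiniteMeasure b] {y : SM}
    (h : y = a.toSignedMeasure - b.toSignedMeasure) : jp y = a - b := by
  rw [h, jp, Measure.toJordanDecomposition_toSignedMeasure_sub]; rfl

lemma jn_eq {a b : Measure EReal} [IsFiniteMeasure a] [IsFiniteMeasure b] {y : SM}
    (h : y = a.toSignedMeasure - b.toSignedMeasure) : jn y = b - a := by
  rw [h, jn, Measure.toJordanDecomposition_toSignedMeasure_sub]; rfl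

lemma sInt_eq {a b : Measure EReal} [IsFiniteMeasure a] [IsFiniteMeasure b] {y : SM}
    (h : y = a.toSignedMeasure - b.toSignedMeasure) {f : EReal → ℝ}
    (ha : Integrable f a) (hb : Integrable f b) :
    sInt f y = ∫ x, f x ∂a - ∫ x, f x ∂b := by
  have hp : Integrable f (jp y) := ha.mono_measure (by rw [jp_eq h]; exact Measure.sub_le)
  have hn : Integrable f (jn y) := hb.mono_measure (by rw [jn_eq h]; exact Measure.sub_le)
  have e := congrArg (fun m => ∫ x, f x ∂m) (jordan_add h)
  beta_reduce at e
  rw [integral_add_measure hp hb, integral_add_measure hn ha] at e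
  unfold sInt
  linarith

lemma MemX.elim {x : SM} (h : MemX x) : ∃ (μ : Measure EReal) (_ : IsProbabilityMeasure μ),
    x = μ.toSignedMeasure ∧ TSymm μ tanhHalf := by
  obtain ⟨⟨μ, hμ, hx⟩, hs⟩ := h
  refine ⟨μ, hμ, hx, ?_⟩
  have : jp x = μ := by
    rw [jp_eq (a := μ) (b := 0) (by rw [hx]; simp)]
    exact Measure.sub_zero
  rw [← this]
  exact hs.1.tsymm

lemma checkFn_measurable :
    Measurable (fun p : EReal × EReal => atanhTwo (tanhHalf p.1 * tanhHalf p.2)) := by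
  have hT := tanhHalf_measurable
  exact atanhTwo_measurable.comp (by fun_prop)

lemma mCheck_add_left (a b c : Measure EReal) [IsFiniteMeasure a] [IsFiniteMeasure b]
    [IsFiniteMeasure c] : mCheck (a + b) c = mCheck a c + mCheck b c := by
  unfold mCheck
  rw [Measure.add_prod, Measure.map_add _ _ checkFn_measurable]

lemma mCheck_add_right (a b c : Measure EReal) [IsFiniteMeasure a] [IsFiniteMeasure b]
    [IsFiniteMeasure c] : mCheck c (a + b) = mCheck c a + mCheck c b := by
  unfold mCheck
  rw [Measure.prod_add, Measure.map_add _ _ checkFn_measurable]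

lemma check_left {p n a b : Measure EReal} [IsFiniteMeasure p] [IsFiniteMeasure n]
    [IsFiniteMeasure a] [IsFiniteMeasure b] (h : p + b = n + a) (c : Measure EReal)
    [IsFiniteMeasure c] :
    (mCheck p c).toSignedMeasure - (mCheck n c).toSignedMeasure
      = (mCheck a c).toSignedMeasure - (mCheck b c).toSignedMeasure := by
  rw [sub_eq_sub_iff_add_eq_add, ← Measure.toSignedMeasure_add, ← Measure.toSignedMeasure_add]
  apply Measure.toSignedMeasure_congr
  rw [← mCheck_add_left, ← mCheck_add_left, h, add_comm]

lemma check_right {p n a b : Measure EReal} [IsFiniteMeasure p] [IsFiniteMeasure n]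
    [IsFiniteMeasure a] [IsFiniteMeasure b] (h : p + b = n + a) (c : Measure EReal)
    [IsFiniteMeasure c] :
    (mCheck c p).toSignedMeasure - (mCheck c n).toSignedMeasure
      = (mCheck c a).toSignedMeasure - (mCheck c b).toSignedMeasure := by
  rw [sub_eq_sub_iff_add_eq_add, ← Measure.toSignedMeasure_add, ← Measure.toSignedMeasure_add]
  apply Measure.toSignedMeasure_congr
  rw [← mCheck_add_right, ← mCheck_add_right, h, add_comm]

lemma sCheck_eq {a b c d : Measure EReal} [IsFiniteMeasure a] [IsFiniteMeasure b]
    [IsFiniteMeasure c] [IsFiniteMeasure d] {x y : SM}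
    (hx : x = a.toSignedMeasure - b.toSignedMeasure)
    (hy : y = c.toSignedMeasure - d.toSignedMeasure) :
    sCheck x y = (mCheck a c + mCheck b d).toSignedMeasure
      - (mCheck a d + mCheck b c).toSignedMeasure := by
  have h1 := jordan_add hx
  have h2 := jordan_add hy
  rw [Measure.toSignedMeasure_add, Measure.toSignedMeasure_add]
  unfold sCheck
  have e1 := check_left h1 (jp y)
  have e2 := check_left h1 (jn y)
  have e3 := check_right h2 a
  have e4 := check_right h2 b
  linear_combination (norm := abel) e1 - e2 + e3 - e4

lemma pow_integrable {Ω : Type*} [MeasurableSpace Ω] (μ : Measure Ω) [IsFiniteMeasure μ]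
    {T : Ω → ℝ} (hT : Measurable T) (hb : ∀ a, |T a| ≤ 1) (k : ℕ) :
    Integrable (fun a => T a ^ k) μ := by
  refine Integrable.of_bound (C := 1) (hT.pow_const k).aestronglyMeasurable
    (ae_of_all _ fun a => ?_)
  rw [norm_pow]
  exact pow_le_one₀ (norm_nonneg _) (hb a)

lemma core_single (μ : Measure EReal) [IsProbabilityMeasure μ] (hs : TSymm μ tanhHalf) :
    Integrable entFn μ ∧
    HasSum (fun k : ℕ => serCoef (k + 1) * ∫ a, tanhHalf a ^ (2 * (k + 1)) ∂μ)
      (1 - ∫ a, entFn a ∂μ) := by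
  have e : entFn = fun a => Lf (tanhHalf a) := funext entFn_eq
  rw [e]
  simpa using core μ tanhHalf tanhHalf_measurable tanhHalf_abs hs

lemma core_check (μ ν : Measure EReal) [IsProbabilityMeasure μ] [IsProbabilityMeasure ν]
    (h1 : TSymm μ tanhHalf) (h2 : TSymm ν tanhHalf) :
    Integrable entFn (mCheck μ ν) ∧
    HasSum (fun k : ℕ => serCoef (k + 1) * ((∫ a, tanhHalf a ^ (2 * (k + 1)) ∂μ)
        * ∫ a, tanhHalf a ^ (2 * (k + 1)) ∂ν))
      (1 - ∫ a, entFn a ∂(mCheck μ ν)) := by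
  have hT := tanhHalf_measurable
  have hb : ∀ p : EReal × EReal, |tanhHalf p.1 * tanhHalf p.2| ≤ 1 := fun p => by
    rw [abs_mul]
    exact mul_le_one₀ (tanhHalf_abs _) (abs_nonneg _) (tanhHalf_abs _)
  have hc := core (μ.prod ν) (fun p : EReal × EReal => tanhHalf p.1 * tanhHalf p.2)
    (by fun_prop) hb (tsymm_prod h1 h2)
  have hm : Measurable entFn := by
    have e : entFn = fun a => Lf (tanhHalf a) := funext entFn_eq
    rw [e]; exact Lf_measurable.comp hT
  have ec : ∀ p : EReal × EReal, entFn (atanhTwo (tanhHalf p.1 * tanhHalf p.2))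
      = Lf (tanhHalf p.1 * tanhHalf p.2) := fun p => by
    rw [entFn_eq, tanhHalf_atanhTwo (hb p)]
  unfold mCheck
  rw [integrable_map_measure hm.aestronglyMeasurable checkFn_measurable.aemeasurable,
    integral_map checkFn_measurable.aemeasurable hm.aestronglyMeasurable]
  simp only [Function.comp_def, ec]
  refine ⟨hc.1, ?_⟩
  have := hc.2
  have ep : ∀ k : ℕ, ∫ p : EReal × EReal, (tanhHalf p.1 * tanhHalf p.2) ^ (2 * (k + 1)) ∂(μ.prod ν)
      = (∫ a, tanhHalf a ^ (2 * (k + 1)) ∂μ) * ∫ a, tanhHalf a ^ (2 * (k + 1)) ∂ν := fun k => by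
    simp only [mul_pow]
    exact integral_prod_mul (μ := μ) (ν := ν) (fun a => tanhHalf a ^ (2 * (k + 1)))
      (fun a => tanhHalf a ^ (2 * (k + 1)))
  simp only [ep] at this
  simpa using this

/-- For all `y1, y2 ∈ X_d` (differences of symmetric probability
measures), `H(y1) = -Σ_{k ≥ 1} (log 2)⁻¹/(2k(2k-1)) · M_k(y1)` and
`H(y1 ⊠ y2) = -Σ_{k ≥ 1} (log 2)⁻¹/(2k(2k-1)) · M_k(y1) M_k(y2)`. -/
theorem entropy_series_difference (y1 y2 : SM) (h1 : MemXd y1) (h2 : MemXd y2) :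
    HasSum (fun k : ℕ => serCoef (k + 1) * Mfun (k + 1) y1) (-H y1) ∧
    HasSum (fun k : ℕ => serCoef (k + 1) * (Mfun (k + 1) y1 * Mfun (k + 1) y2))
      (-H (sCheck y1 y2)) := by
  obtain ⟨x1, x2, hx1, hx2, hy1⟩ := h1
  obtain ⟨x3, x4, hx3, hx4, hy2⟩ := h2
  obtain ⟨a, _, ha, sa⟩ := hx1.elim
  obtain ⟨b, _, hb, sb⟩ := hx2.elim
  obtain ⟨c, _, hc, sc⟩ := hx3.elim
  obtain ⟨d, _, hd, sd⟩ := hx4.elim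
  rw [ha, hb] at hy1
  rw [hc, hd] at hy2
  have M1 : ∀ k, Mfun k y1 = _ := fun k => sInt_eq hy1
    (pow_integrable a tanhHalf_measurable tanhHalf_abs (2 * k))
    (pow_integrable b tanhHalf_measurable tanhHalf_abs (2 * k))
  have M2 : ∀ k, Mfun k y2 = _ := fun k => sInt_eq hy2
    (pow_integrable c tanhHalf_measurable tanhHalf_abs (2 * k))
    (pow_integrable d tanhHalf_measurable tanhHalf_abs (2 * k))
  simp only [M1, M2]
  constructor
  · obtain ⟨ia, ka⟩ := core_single a sa
    obtain ⟨ib, kb⟩ := core_single b sb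
    have hH : H y1 = _ := sInt_eq hy1 ia ib
    rw [hH]
    convert! ka.sub kb using 1
    · funext k; ring
    · ring
  · obtain ⟨iac, kac⟩ := core_check a c sa sc
    obtain ⟨iad, kad⟩ := core_check a d sa sd
    obtain ⟨ibc, kbc⟩ := core_check b c sb sc
    obtain ⟨ibd, kbd⟩ := core_check b d sb sd
    have hH : H (sCheck y1 y2) = _ := sInt_eq (sCheck_eq hy1 hy2)
      (iac.add_measure ibd) (iad.add_measure ibc)
    rw [hH, integral_add_measure iac ibd, integral_add_measure iad ibc]
    convert! (kac.add kbd).sub (kad.add kbc) using 1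
    · funext k; ring
    · ring

end SCLDPC
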